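/- arXiv:1412.5422 — 15 statements merged into one kernel-verified Lean document; each statement's English description precedes it below -/
import Mathlib

section
/- Let I be an interval of real numbers, let f, l : ℝ → ℝ be differentiable at a point x₀ ∈ I, and define k = 0 if l′(x₀) = 0 and k = f′(x₀)/l′(x₀) otherwise, and m = f(x₀) − k·l(x₀). If f(x) ≥ k·l(x) + m for every x ∈ I, then for every natural number n and all points x₁, …, xₙ ∈ I satisfying Σ_{j=1}^{n} l(x_j) = n·l(x₀), one has Σ_{j=1}^{n} f(x_j) ≥ n·f(x₀). -/
theorem stmt_2 (I : Set ℝ) (f l : ℝ → ℝ) (x₀ : ℝ) (hx₀ : x₀ ∈ I)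
    (hf : DifferentiableAt ℝ f x₀) (hl : DifferentiableAt ℝ l x₀)
    (k m : ℝ)
    (hk : k = if deriv l x₀ = 0 then 0 else deriv f x₀ / deriv l x₀)
    (hm : m = f x₀ - k * l x₀)
    (hbase : ∀ x ∈ I, f x ≥ k * l x + m) :
    ∀ (n : ℕ) (x : Fin n → ℝ), (∀ j, x j ∈ I) →
      (∑ j, l (x j)) = n * l x₀ →
      (∑ j, f (x j)) ≥ n * f x₀ := by
  intro n x hx hsum
  calc ∑ j, f (x j) ≥ ∑ j, (k * l (x j) + m) := Finset.sum_le_sum fun j _ => hbase _ (hx j)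
    _ = k * ∑ j, l (x j) + n * m := by simp [Finset.sum_add_distrib, Finset.mul_sum]
    _ = n * f x₀ := by rw [hsum, hm]; ring
end

section
/- Let I be an interval of real numbers, G a subset of I, and x₀ ∈ I \ G. Let f, l : ℝ → ℝ be differentiable at x₀, and suppose f attains a minimum value min_G f on G and a minimum value min_I f on I. Define k = 0 if l′(x₀) = 0 and k = f′(x₀)/l′(x₀) otherwise, and m = f(x₀) − k·l(x₀). Let n be a natural number. If min_G f + (n − 1)·min_I f ≥ n·f(x₀), and f(x) ≥ k·l(x) + m for every x ∈ I \ G, then for all points x₁, …, xₙ ∈ I satisfying Σ_{j=1}^{n} l(x_j) = n·l(x₀), one has Σ_{j=1}^{n} f(x_j) ≥ n·f(x₀). -/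
theorem stmt_3 (I G : Set ℝ) (hGI : G ⊆ I) (f l : ℝ → ℝ) (x₀ : ℝ)
    (hx₀ : x₀ ∈ I \ G)
    (hf : DifferentiableAt ℝ f x₀) (hl : DifferentiableAt ℝ l x₀)
    (mG mI : ℝ) (hmG : IsLeast (f '' G) mG) (hmI : IsLeast (f '' I) mI)
    (k m : ℝ)
    (hk : k = if deriv l x₀ = 0 then 0 else deriv f x₀ / deriv l x₀)
    (hm : m = f x₀ - k * l x₀)
    (n : ℕ)
    (hmin : mG + (n - 1 : ℝ) * mI ≥ n * f x₀)
    (hbase : ∀ x ∈ I \ G, f x ≥ k * l x + m) :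
    ∀ x : Fin n → ℝ, (∀ j, x j ∈ I) →
      (∑ j, l (x j)) = n * l x₀ →
      (∑ j, f (x j)) ≥ n * f x₀ := by
  intro x hxI hsum
  by_cases h : ∃ i, x i ∈ G
  · obtain ⟨i, hi⟩ := h
    have h_rest : ∑ j ∈ Finset.univ.erase i, mI ≤ ∑ j ∈ Finset.univ.erase i, f (x j) :=
      Finset.sum_le_sum fun j _ => hmI.2 ⟨x j, hxI j, rfl⟩
    have h_const := Finset.add_sum_erase Finset.univ (fun _ : Fin n => mI) (Finset.mem_univ i)
    have h_split := Finset.add_sum_erase Finset.univ (fun j => f (x j)) (Finset.mem_univ i)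
    have h_min : mG ≤ f (x i) := hmG.2 ⟨x i, hi, rfl⟩
    simp only [Finset.sum_const (s := Finset.univ), Finset.card_univ, Fintype.card_fin,
      nsmul_eq_mul] at h_const
    linarith
  · push Not at h
    calc ∑ j, f (x j) ≥ ∑ j, (k * l (x j) + m) :=
          Finset.sum_le_sum fun j _ => hbase (x j) ⟨hxI j, h j⟩
      _ = n * f x₀ := by
          rw [Finset.sum_add_distrib, ← Finset.mul_sum, hsum, hm]
          simp
          ring
end

section
/- Let α be a nonzero real number, x₀ a positive real number, and n ≥ 2 a natural number. Let f : ℝ → ℝ be defined on the positive reals and differentiable at x₀. Suppose (α − 1)·f′(x₀) ≤ 0, and that for every positive real x with x^α < n·x₀^α one has f(x) ≥ f(x₀) + f′(x₀)·(x − x₀). Then for all positive reals x₁, …, xₙ satisfying Σ_{j=1}^{n} x_j^α = n·x₀^α, one has Σ_{j=1}^{n} f(x_j) ≥ n·f(x₀). -/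
/-- Bernoulli's inequality for negative real exponents. -/
theorem one_add_mul_sub_one_le_rpow_of_neg {α t : ℝ} (hα : α < 0) (ht : 0 < t) :
    1 + α * (t - 1) ≤ t ^ α := by
  have hlog : Real.log t ≤ t - 1 := Real.log_le_sub_one_of_pos ht
  have hexp := Real.add_one_le_exp (Real.log t * α)
  rw [Real.rpow_def_of_pos ht]
  nlinarith

/-- Bernoulli's inequality for real exponents: the position of the graph of `t ↦ t ^ α` relative
to its tangent at `1`, in terms of the sign of `α - 1`. -/
theorem mul_sub_one_le_mul_rpow_sub_one_div {α d t : ℝ} (hα : α ≠ 0) (hd : (α - 1) * d ≤ 0)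
    (ht : 0 < t) : d * ((t ^ α - 1) / α) ≤ d * (t - 1) := by
  have hs : -1 ≤ t - 1 := by linarith
  rcases lt_trichotomy α 1 with hα1 | rfl | hα1
  · refine mul_le_mul_of_nonneg_left ?_ (by nlinarith)
    rcases hα.lt_or_gt with hneg | hpos
    · rw [div_le_iff_of_neg hneg]
      linarith [one_add_mul_sub_one_le_rpow_of_neg hneg ht]
    · have hb := rpow_one_add_le_one_add_mul_self hs hpos.le hα1.le
      rw [add_sub_cancel] at hb
      rw [div_le_iff₀ hpos]
      linarith
  · simp
  · refine mul_le_mul_of_nonpos_left ?_ (by nlinarith)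
    have hb := one_add_mul_self_le_rpow_one_add hs hα1.le
    rw [add_sub_cancel] at hb
    rw [le_div_iff₀ (by linarith)]
    linarith

/-- Comparison of the arithmetic mean with the power mean `c` of order `α` of positive reals. -/
theorem mul_sum_sub_nonneg_of_sum_rpow_eq {ι : Type*} [Fintype ι] {α c d : ℝ} (hα : α ≠ 0)
    (hd : (α - 1) * d ≤ 0) (hc : 0 < c) {x : ι → ℝ} (hx : ∀ j, 0 < x j)
    (hsum : ∑ j, x j ^ α = Fintype.card ι * c ^ α) : 0 ≤ ∑ j, d * (x j - c) := by
  have hcα : c ^ α ≠ 0 := (Real.rpow_pos_of_pos hc α).ne'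
  have hmean : ∑ j, ((x j / c) ^ α - 1) = 0 := by
    simp_rw [fun j => Real.div_rpow (hx j).le hc.le α]
    rw [Finset.sum_sub_distrib, ← Finset.sum_div, hsum]
    simp [hcα]
  calc
    0 = c * ∑ j, d * (((x j / c) ^ α - 1) / α) := by
      rw [← Finset.mul_sum, ← Finset.sum_div, hmean]
      simp
    _ ≤ c * ∑ j, d * (x j / c - 1) := by
      gcongr c * ?_
      exact Finset.sum_le_sum fun j _ =>
        mul_sub_one_le_mul_rpow_sub_one_div hα hd (div_pos (hx j) hc)
    _ = ∑ j, d * (x j - c) := by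
      rw [Finset.mul_sum]
      exact Finset.sum_congr rfl fun j _ => by field_simp

theorem stmt_4 (α : ℝ) (hα : α ≠ 0) (x₀ : ℝ) (hx₀ : 0 < x₀)
    (n : ℕ) (hn : 2 ≤ n) (f : ℝ → ℝ)
    (hf : DifferentiableAt ℝ f x₀)
    (hsign : (α - 1) * deriv f x₀ ≤ 0)
    (hbase : ∀ x : ℝ, 0 < x → x ^ α < n * x₀ ^ α →
      f x ≥ f x₀ + deriv f x₀ * (x - x₀)) :
    ∀ x : Fin n → ℝ, (∀ j, 0 < x j) →
      (∑ j, x j ^ α) = n * x₀ ^ α →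
      (∑ j, f (x j)) ≥ n * f x₀ := by
  intro x hx hsum
  have : Nontrivial (Fin n) := Fin.nontrivial_iff_two_le.mpr hn
  have hpow (j : Fin n) : 0 < x j ^ α := Real.rpow_pos_of_pos (hx j) α
  have hlt (j : Fin n) : x j ^ α < n * x₀ ^ α := by
    obtain ⟨k, hk⟩ := exists_ne j
    rw [← hsum]
    exact Finset.single_lt_sum hk (Finset.mem_univ j) (Finset.mem_univ k) (hpow k)
      fun i _ _ => (hpow i).le
  have hmean : 0 ≤ ∑ j, deriv f x₀ * (x j - x₀) :=
    mul_sum_sub_nonneg_of_sum_rpow_eq hα hsign hx₀ hx (by simpa using hsum)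
  calc
    (n : ℝ) * f x₀ ≤ n * f x₀ + ∑ j, deriv f x₀ * (x j - x₀) := le_add_of_nonneg_right hmean
    _ = ∑ j, (f x₀ + deriv f x₀ * (x j - x₀)) := by simp [Finset.sum_add_distrib]
    _ ≤ ∑ j, f (x j) := Finset.sum_le_sum fun j _ => hbase (x j) (hx j) (hlt j)
end

section
/- Let α be a nonzero real number, x₀ a positive real number, and n ≥ 2 a natural number. Let f : ℝ → ℝ be defined on the positive reals and differentiable at x₀. Suppose (α − 1)·f′(x₀) ≥ 0, and that for every positive real x with x < n·x₀ one has f(x) ≥ (f′(x₀)/(α·x₀^{α−1}))·(x^α − x₀^α) + f(x₀). Then for all positive reals x₁, …, xₙ satisfying x₁ + x₂ + ⋯ + xₙ = n·x₀, one has Σ_{j=1}^{n} f(x_j) ≥ n·f(x₀). -/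
/-- Bernoulli's inequality for exponents at least one, in the form `y - 1 ≤ (y ^ p - 1) / p`. -/
theorem sub_one_le_rpow_sub_one_div {y p : ℝ} (hy : 0 < y) (hp : 1 ≤ p) :
    y - 1 ≤ (y ^ p - 1) / p := by
  have h := one_add_mul_self_le_rpow_one_add (s := y - 1) (by linarith) hp
  rw [add_sub_cancel] at h
  rw [le_div_iff₀ (by linarith)]
  linarith

/-- Bernoulli's inequality for nonzero exponents at most one, in the form
`(y ^ p - 1) / p ≤ y - 1`. -/
theorem rpow_sub_one_div_le_sub_one {y p : ℝ} (hy : 0 < y) (hp₀ : p ≠ 0) (hp : p ≤ 1) :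
    (y ^ p - 1) / p ≤ y - 1 := by
  rcases hp₀.lt_or_gt with hneg | hpos
  · have h := one_add_mul_self_le_rpow_one_add (s := y⁻¹ - 1) (p := 1 - p)
      (by linarith [inv_pos.mpr hy]) (by linarith)
    rw [add_sub_cancel, Real.inv_rpow hy.le, ← Real.rpow_neg hy.le, neg_sub,
      Real.rpow_sub_one hy.ne', le_div_iff₀ hy] at h
    rw [div_le_iff_of_neg hneg]
    have hyy : y⁻¹ * y = 1 := inv_mul_cancel₀ hy.ne'
    linear_combination h - (1 - p) * hyy
  · have h := rpow_one_add_le_one_add_mul_self (s := y - 1) (by linarith) hpos.le hp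
    rw [add_sub_cancel] at h
    rw [div_le_iff₀ hpos]
    linarith

/-- The power curve through `x₀` with slope `c` there lies above its tangent line at `x₀`
as soon as `0 ≤ (p - 1) * c`. -/
theorem mul_sub_le_div_mul_rpow_sub_rpow {p x₀ c x : ℝ} (hp₀ : p ≠ 0) (hx₀ : 0 < x₀)
    (hx : 0 < x) (hc : 0 ≤ (p - 1) * c) :
    c * (x - x₀) ≤ c / (p * x₀ ^ (p - 1)) * (x ^ p - x₀ ^ p) := by
  have hpow : 0 < x₀ ^ p := Real.rpow_pos_of_pos hx₀ p
  have hright : c / (p * x₀ ^ (p - 1)) * (x ^ p - x₀ ^ p) =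
      x₀ * (c * (((x / x₀) ^ p - 1) / p)) := by
    rw [Real.div_rpow hx.le hx₀.le, Real.rpow_sub_one hx₀.ne']
    field_simp
  have hleft : c * (x - x₀) = x₀ * (c * (x / x₀ - 1)) := by field_simp
  rw [hright, hleft]
  refine mul_le_mul_of_nonneg_left ?_ hx₀.le
  have hy : 0 < x / x₀ := div_pos hx hx₀
  rcases lt_trichotomy p 1 with hp | rfl | hp
  · exact mul_le_mul_of_nonpos_left (rpow_sub_one_div_le_sub_one hy hp₀ hp.le)
      (nonpos_of_mul_nonneg_right hc (by linarith))
  · simp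
  · exact mul_le_mul_of_nonneg_left (sub_one_le_rpow_sub_one_div hy hp.le)
      (nonneg_of_mul_nonneg_right hc (by linarith))

theorem stmt_5 (α : ℝ) (hα : α ≠ 0) (x₀ : ℝ) (hx₀ : 0 < x₀)
    (n : ℕ) (hn : 2 ≤ n) (f : ℝ → ℝ)
    (hf : DifferentiableAt ℝ f x₀)
    (hsign : (α - 1) * deriv f x₀ ≥ 0)
    (hbase : ∀ x : ℝ, 0 < x → x < n * x₀ →
      f x ≥ (deriv f x₀ / (α * x₀ ^ (α - 1))) * (x ^ α - x₀ ^ α) + f x₀) :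
    ∀ x : Fin n → ℝ, (∀ j, 0 < x j) →
      (∑ j, x j) = n * x₀ →
      (∑ j, f (x j)) ≥ n * f x₀ := by
  intro x hx hsum
  have : Nontrivial (Fin n) := Fin.nontrivial_iff_two_le.mpr hn
  have htangent : ∀ j, deriv f x₀ * (x j - x₀) + f x₀ ≤ f (x j) := by
    intro j
    obtain ⟨k, hk⟩ := exists_ne j
    have hlt : x j < n * x₀ := hsum ▸ Finset.single_lt_sum hk (Finset.mem_univ j)
      (Finset.mem_univ k) (hx k) fun i _ _ => (hx i).le
    linarith [hbase (x j) (hx j) hlt, mul_sub_le_div_mul_rpow_sub_rpow hα hx₀ (hx j) hsign]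
  calc (n : ℝ) * f x₀ = ∑ j, (deriv f x₀ * (x j - x₀) + f x₀) := by
        simp [Finset.sum_add_distrib, ← Finset.mul_sum, hsum]
    _ ≤ ∑ j, f (x j) := Finset.sum_le_sum fun j _ => htangent j
end

section
/- Let P(x) = a·x³ + b·x² + c·x + d be a real cubic polynomial with a ≠ 0, let n be a positive natural number, and let x₀ be a positive real number. Let x₁, …, xₙ be nonnegative real numbers with x₁ + ⋯ + xₙ = n·x₀. If 2·a·x₀ + b ≥ 0 and (n + 2)·a·x₀ + b ≥ 0, then Σ_{j=1}^{n} P(x_j) ≥ n·P(x₀). -/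
/-- An affine function that is nonnegative at `0` and at `t > 0` is nonnegative on `[0, t]`. -/
theorem affine_nonneg_of_endpoints {m k t y : ℝ} (ht : 0 < t) (hy0 : 0 ≤ y) (hyt : y ≤ t)
    (h0 : 0 ≤ k) (h1 : 0 ≤ m * t + k) : 0 ≤ m * y + k := by
  refine nonneg_of_mul_nonneg_right ?_ ht
  have h : t * (m * y + k) = (t - y) * k + y * (m * t + k) := by ring
  rw [h]
  exact add_nonneg (mul_nonneg (sub_nonneg.2 hyt) h0) (mul_nonneg hy0 h1)

/-- A cubic lies above its tangent line at `x₀` wherever the cofactor of `(y - x₀) ^ 2` in their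
difference is nonnegative. -/
theorem cubic_tangent_le {a b c d x₀ y : ℝ} (h : 0 ≤ a * y + (2 * a * x₀ + b)) :
    (a * x₀ ^ 3 + b * x₀ ^ 2 + c * x₀ + d) + (3 * a * x₀ ^ 2 + 2 * b * x₀ + c) * (y - x₀) ≤
      a * y ^ 3 + b * y ^ 2 + c * y + d := by
  linear_combination mul_nonneg (sq_nonneg (y - x₀)) h

theorem stmt_6 (a b c d : ℝ) (ha : a ≠ 0) (n : ℕ) (hn : 0 < n)
    (x₀ : ℝ) (hx₀ : 0 < x₀)
    (P : ℝ → ℝ) (hP : ∀ x, P x = a * x ^ 3 + b * x ^ 2 + c * x + d)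
    (x : Fin n → ℝ) (hx : ∀ j, 0 ≤ x j) (hsum : (∑ j, x j) = n * x₀)
    (h1 : 2 * a * x₀ + b ≥ 0) (h2 : (n + 2 : ℝ) * a * x₀ + b ≥ 0) :
    (∑ j, P (x j)) ≥ n * P x₀ := by
  have tangent_le (j : Fin n) :
      P x₀ + (3 * a * x₀ ^ 2 + 2 * b * x₀ + c) * (x j - x₀) ≤ P (x j) := by
    have hle : x j ≤ n * x₀ :=
      hsum ▸ Finset.single_le_sum (fun i _ => hx i) (Finset.mem_univ j)
    rw [hP, hP]
    exact cubic_tangent_le (affine_nonneg_of_endpoints (by positivity) (hx j) hle h1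
      (by linear_combination h2))
  calc (n : ℝ) * P x₀
      = ∑ j, (P x₀ + (3 * a * x₀ ^ 2 + 2 * b * x₀ + c) * (x j - x₀)) := by
        simp [Finset.sum_add_distrib, ← Finset.mul_sum, hsum]
    _ ≤ ∑ j, P (x j) := Finset.sum_le_sum fun j _ => tangent_le j
end

section
/- Let a, b, c, d be positive real numbers with a + b + c + d = 4. Then a/(a³ + 8) + b/(b³ + 8) + c/(c³ + 8) + d/(d³ + 8) ≤ 4/9. -/
/-- The graph of `x / (x ^ 3 + 8)` lies below its tangent line at `1` on the positive reals. -/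
theorem div_cube_add_eight_le_tangent {x : ℝ} (hx : 0 < x) :
    x / (x ^ 3 + 8) ≤ (2 * x + 1) / 27 := by
  have h : 0 ≤ (x - 1) ^ 2 * (2 * x ^ 2 + 5 * x + 8) := by positivity
  rw [div_le_div_iff₀ (by positivity) (by norm_num)]
  linarith

theorem stmt_9 (a b c d : ℝ) (ha : 0 < a) (hb : 0 < b) (hc : 0 < c) (hd : 0 < d)
    (hsum : a + b + c + d = 4) :
    a / (a ^ 3 + 8) + b / (b ^ 3 + 8) + c / (c ^ 3 + 8) + d / (d ^ 3 + 8) ≤ 4 / 9 := by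
  linarith [div_cube_add_eight_le_tangent ha, div_cube_add_eight_le_tangent hb,
    div_cube_add_eight_le_tangent hc, div_cube_add_eight_le_tangent hd]
end

section
/- Let a, b, c, d be positive real numbers with a + b + c + d = 4. Then a/(a³ + 4) + b/(b³ + 4) + c/(c³ + 4) + d/(d³ + 4) ≤ 4/5. -/
/-- The graph of `x / (x ^ 3 + 4)` lies below its tangent line at `1` for nonnegative `x`. -/
theorem div_cube_add_four_le_tangent {x : ℝ} (hx : 0 ≤ x) :
    x / (x ^ 3 + 4) ≤ (2 * x + 3) / 25 := by
  have hfactor : 0 ≤ (x - 1) ^ 2 * (2 * x ^ 2 + 7 * x + 12) := by positivity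
  rw [div_le_div_iff₀ (by positivity) (by norm_num)]
  linarith

theorem stmt_10 (a b c d : ℝ) (ha : 0 < a) (hb : 0 < b) (hc : 0 < c) (hd : 0 < d)
    (hsum : a + b + c + d = 4) :
    a / (a ^ 3 + 4) + b / (b ^ 3 + 4) + c / (c ^ 3 + 4) + d / (d ^ 3 + 4) ≤ 4 / 5 := by
  linarith [div_cube_add_four_le_tangent ha.le, div_cube_add_four_le_tangent hb.le,
    div_cube_add_four_le_tangent hc.le, div_cube_add_four_le_tangent hd.le]
end

section
/- Let a, b, c be positive real numbers with a² + b² + c² = 3. Then 1/(a³ + 2) + 1/(b³ + 2) + 1/(c³ + 2) ≥ 1. -/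
theorem half_sub_sq_div_six_le_one_div_cube_add_two {x : ℝ} (hx : 0 ≤ x) :
    1 / 2 - x ^ 2 / 6 ≤ 1 / (x ^ 3 + 2) := by
  rw [le_div_iff₀ (by positivity)]
  have h : 0 ≤ x ^ 2 * (x - 1) ^ 2 * (x + 2) := by positivity
  linarith

theorem stmt_11 (a b c : ℝ) (ha : 0 < a) (hb : 0 < b) (hc : 0 < c)
    (hsum : a ^ 2 + b ^ 2 + c ^ 2 = 3) :
    1 / (a ^ 3 + 2) + 1 / (b ^ 3 + 2) + 1 / (c ^ 3 + 2) ≥ 1 := by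
  linarith [half_sub_sq_div_six_le_one_div_cube_add_two ha.le,
    half_sub_sq_div_six_le_one_div_cube_add_two hb.le,
    half_sub_sq_div_six_le_one_div_cube_add_two hc.le]
end

section
/- Let a, b, c, d, e be positive real numbers satisfying 1/(4 + a) + 1/(4 + b) + 1/(4 + c) + 1/(4 + d) + 1/(4 + e) = 1. Then a/(4 + a²) + b/(4 + b²) + c/(4 + c²) + d/(4 + d²) + e/(4 + e²) ≤ 1. -/
/-- A separating base curve for `x / (4 + x ^ 2)`, touching it at `x = 1`. -/
theorem div_four_add_sq_le {x : ℝ} (hx : 0 ≤ x) :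
    x / (4 + x ^ 2) ≤ 4 / 5 - 3 * (1 / (4 + x)) := by
  have h : 4 / 5 - 3 * (1 / (4 + x)) - x / (4 + x ^ 2) =
      4 * ((x - 1) ^ 2 * (x + 1)) / (5 * (4 + x) * (4 + x ^ 2)) := by
    have : 4 + x ≠ 0 := by positivity
    have : 4 + x ^ 2 ≠ 0 := by positivity
    field_simp
    ring
  rw [← sub_nonneg, h]
  positivity

theorem stmt_12 (a b c d e : ℝ) (ha : 0 < a) (hb : 0 < b) (hc : 0 < c)
    (hd : 0 < d) (he : 0 < e)
    (hsum : 1 / (4 + a) + 1 / (4 + b) + 1 / (4 + c) + 1 / (4 + d) + 1 / (4 + e) = 1) :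
    a / (4 + a ^ 2) + b / (4 + b ^ 2) + c / (4 + c ^ 2) + d / (4 + d ^ 2) + e / (4 + e ^ 2) ≤ 1 := by
  linarith [div_four_add_sq_le ha.le, div_four_add_sq_le hb.le, div_four_add_sq_le hc.le,
    div_four_add_sq_le hd.le, div_four_add_sq_le he.le]
end

section
/- Let a, b, c be positive real numbers with a + b + c = 1. Then 10·(a³ + b³ + c³) − 9·(a⁵ + b⁵ + c⁵) ≥ 1. -/
theorem tangent_line_le_quintic {x : ℝ} (h0 : 0 ≤ x) (h1 : x ≤ 9 / 10) :
    25 / 9 * x - 16 / 27 ≤ 10 * x ^ 3 - 9 * x ^ 5 := by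
  have hq : 0 ≤ -9 * x ^ 3 - 6 * x ^ 2 + 7 * x + 16 / 3 := by
    have h2 : x ^ 2 ≤ 9 / 10 * x := by nlinarith
    have h3 : x ^ 3 ≤ 81 / 100 * x := by nlinarith
    linarith
  linear_combination mul_nonneg (sq_nonneg (x - 1 / 3)) hq

theorem quintic_nonneg {x : ℝ} (h0 : 0 ≤ x) (h1 : x ≤ 1) :
    0 ≤ 10 * x ^ 3 - 9 * x ^ 5 := by
  have h : 0 ≤ 10 - 9 * x ^ 2 := by nlinarith
  linear_combination mul_nonneg (pow_nonneg h0 3) h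

theorem one_le_quintic {x : ℝ} (h0 : 9 / 10 ≤ x) (h1 : x ≤ 1) :
    1 ≤ 10 * x ^ 3 - 9 * x ^ 5 := by
  have h2 : 81 / 100 ≤ x ^ 2 := by nlinarith
  have h3 : 729 / 1000 ≤ x ^ 3 := by nlinarith
  have h4 : 0 ≤ x ^ 4 := by positivity
  have hq : 0 ≤ 9 * x ^ 4 + 9 * x ^ 3 - x ^ 2 - x - 1 := by nlinarith
  linear_combination mul_nonneg (sub_nonneg.2 h1) hq

theorem stmt_13 (a b c : ℝ) (ha : 0 < a) (hb : 0 < b) (hc : 0 < c)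
    (hsum : a + b + c = 1) :
    10 * (a ^ 3 + b ^ 3 + c ^ 3) - 9 * (a ^ 5 + b ^ 5 + c ^ 5) ≥ 1 := by
  have ha1 : a ≤ 1 := by linarith
  have hb1 : b ≤ 1 := by linarith
  have hc1 : c ≤ 1 := by linarith
  have ha0 := quintic_nonneg ha.le ha1
  have hb0 := quintic_nonneg hb.le hb1
  have hc0 := quintic_nonneg hc.le hc1
  rcases le_total (9 / 10) a with h | ha9
  · linarith [one_le_quintic h ha1]
  rcases le_total (9 / 10) b with h | hb9
  · linarith [one_le_quintic h hb1]
  rcases le_total (9 / 10) c with h | hc9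
  · linarith [one_le_quintic h hc1]
  linarith [tangent_line_le_quintic ha.le ha9, tangent_line_le_quintic hb.le hb9,
    tangent_line_le_quintic hc.le hc9]
end

section
/- Let a, b, c be positive real numbers with a² + b² + c² = 12. Then a·(b² + c²)^{1/3} + b·(c² + a²)^{1/3} + c·(a² + b²)^{1/3} ≤ 12, with equality when a = b = c = 2; that is, the maximum value of a·∛(b² + c²) + b·∛(c² + a²) + c·∛(a² + b²) subject to a² + b² + c² = 12 and a, b, c > 0 equals 12. -/
/-- A consequence of AM-GM for `x, 8, 8`: the cube root lies below its tangent line at `8`. -/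
lemma rpow_one_third_le_tangent {x : ℝ} (hx : 0 ≤ x) :
    x ^ ((1 : ℝ) / 3) ≤ (x + 16) / 12 := by
  have ht : 0 ≤ x ^ ((1 : ℝ) / 3) := by positivity
  have hcube : (x ^ ((1 : ℝ) / 3)) ^ 3 = x := by
    rw [← Real.rpow_natCast, ← Real.rpow_mul hx]
    norm_num
  nlinarith [mul_nonneg (by linarith : 0 ≤ x ^ ((1 : ℝ) / 3) + 4)
    (sq_nonneg (x ^ ((1 : ℝ) / 3) - 2))]

lemma mul_rpow_one_third_le {a x : ℝ} (ha : 0 ≤ a) (hx : 0 ≤ x) (h : a ^ 2 + x = 12) :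
    a * x ^ ((1 : ℝ) / 3) ≤ (8 + a ^ 2) / 3 := by
  have h1 := mul_le_mul_of_nonneg_left (rpow_one_third_le_tangent hx) ha
  obtain rfl : x = 12 - a ^ 2 := by linarith
  nlinarith [mul_nonneg (by linarith : 0 ≤ a + 8) (sq_nonneg (a - 2))]

theorem stmt_14 :
    IsGreatest {A : ℝ | ∃ a b c : ℝ, 0 < a ∧ 0 < b ∧ 0 < c ∧
      a ^ 2 + b ^ 2 + c ^ 2 = 12 ∧
      A = a * (b ^ 2 + c ^ 2) ^ ((1 : ℝ) / 3) + b * (c ^ 2 + a ^ 2) ^ ((1 : ℝ) / 3)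
          + c * (a ^ 2 + b ^ 2) ^ ((1 : ℝ) / 3)} 12 := by
  constructor
  · refine ⟨2, 2, 2, by norm_num, by norm_num, by norm_num, by norm_num, ?_⟩
    have h : ((2 : ℝ) ^ 2 + 2 ^ 2) ^ ((1 : ℝ) / 3) = 2 := by
      rw [show (2 : ℝ) ^ 2 + 2 ^ 2 = 2 ^ (3 : ℝ) by norm_num, ← Real.rpow_mul (by norm_num)]
      norm_num
    rw [h]
    norm_num
  · rintro _ ⟨a, b, c, ha, hb, hc, h, rfl⟩
    have h1 := mul_rpow_one_third_le ha.le (x := b ^ 2 + c ^ 2) (by positivity) (by linarith)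
    have h2 := mul_rpow_one_third_le hb.le (x := c ^ 2 + a ^ 2) (by positivity) (by linarith)
    have h3 := mul_rpow_one_third_le hc.le (x := a ^ 2 + b ^ 2) (by positivity) (by linarith)
    linarith
end

section
/- Let n be a positive natural number and let x₁, x₂, …, xₙ be nonnegative real numbers with Σ_{k=1}^{n} x_k = 1. Then Σ_{k=1}^{n} x_k·(1 − x_k)² ≤ (1 − 1/n)². -/
/-- The tangent line at `a ≤ 1 / 2` lies above the cubic `t * (1 - t) ^ 2` for `t ≤ 1`. -/
theorem mul_one_sub_sq_le_tangent {a t : ℝ} (ha : a ≤ 1 / 2) (ht : t ≤ 1) :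
    t * (1 - t) ^ 2 ≤ a * (1 - a) ^ 2 + (1 - a) * (1 - 3 * a) * (t - a) := by
  have h : 0 ≤ (t - a) ^ 2 * (2 - 2 * a - t) :=
    mul_nonneg (sq_nonneg _) (by linarith)
  linarith

theorem stmt_15 (n : ℕ) (hn : 0 < n) (x : Fin n → ℝ) (hx : ∀ k, 0 ≤ x k)
    (hsum : (∑ k, x k) = 1) :
    (∑ k, x k * (1 - x k) ^ 2) ≤ (1 - 1 / (n : ℝ)) ^ 2 := by
  obtain rfl | hn2 : n = 1 ∨ 2 ≤ n := by omega
  · have h0 : x 0 = 1 := by simpa using hsum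
    simp [h0]
  have hle (k : Fin n) : x k ≤ 1 :=
    hsum ▸ Finset.single_le_sum (fun i _ => hx i) (Finset.mem_univ k)
  have ha : 1 / (n : ℝ) ≤ 1 / 2 :=
    one_div_le_one_div_of_le two_pos (by exact_mod_cast hn2)
  have hna : (n : ℝ) * (1 / n) = 1 := mul_one_div_cancel (by positivity)
  generalize 1 / (n : ℝ) = a at ha hna ⊢
  calc ∑ k, x k * (1 - x k) ^ 2
      ≤ ∑ k, (a * (1 - a) ^ 2 + (1 - a) * (1 - 3 * a) * (x k - a)) :=
        Finset.sum_le_sum fun k _ => mul_one_sub_sq_le_tangent ha (hle k)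
    _ = n * a * (1 - a) ^ 2 + (1 - a) * (1 - 3 * a) * (1 - n * a) := by
        simp [Finset.sum_add_distrib, ← Finset.mul_sum, hsum, mul_assoc]
    _ = (1 - a) ^ 2 := by rw [hna]; ring
end

section
/- For every real number x with 0 ≤ x ≤ 1, one has √(1 − x) − √x ≥ −√2·(x² − 1/4). -/
theorem stmt_16 (x : ℝ) (h0 : 0 ≤ x) (h1 : x ≤ 1) :
    Real.sqrt (1 - x) - Real.sqrt x ≥ -Real.sqrt 2 * (x ^ 2 - 1 / 4) := by
  have ha2 : Real.sqrt (1 - x) ^ 2 = 1 - x := Real.sq_sqrt (by linarith)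
  have hb2 : Real.sqrt x ^ 2 = x := Real.sq_sqrt h0
  have hs2 : Real.sqrt 2 ^ 2 = 2 := Real.sq_sqrt (by norm_num)
  have ha := Real.sqrt_nonneg (1 - x)
  have hb := Real.sqrt_nonneg x
  have hs := Real.sqrt_nonneg 2
  set a := Real.sqrt (1 - x)
  set b := Real.sqrt x
  set s := Real.sqrt 2
  have ht : 0 < a + b := by nlinarith
  have hst : (s * (a + b)) ^ 2 = 2 * (1 + 2 * (a * b)) := by
    linear_combination (a + b) ^ 2 * hs2 + 2 * ha2 + 2 * hb2
  have hab : a * b ≤ 1 / 2 := by nlinarith [sq_nonneg (a - b)]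
  have hab2 : (a * b) ^ 2 = x * (1 - x) := by rw [mul_pow, ha2, hb2]; ring
  have key : 0 ≤ (x - 1 / 2) * (s * (a + b) * (x + 1 / 2) - 2) := by
    rcases le_total x (1 / 2) with hx | hx
    · have hle : s * (a + b) ≤ 2 := abs_le_of_sq_le_sq' (by linarith) (by norm_num) |>.2
      have : s * (a + b) * (x + 1 / 2) ≤ 2 * 1 :=
        mul_le_mul hle (by linarith) (by linarith) (by norm_num)
      exact mul_nonneg_of_nonpos_of_nonpos (by linarith) (by linarith)
    · refine mul_nonneg (by linarith) (sub_nonneg.2 (abs_le_of_sq_le_sq' ?_ (by positivity)).2)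
      have hq : 2 * (x * (1 - x)) ≤ a * b := by
        rw [← hab2]
        nlinarith [mul_nonneg ha hb]
      rw [mul_pow, hst]
      have hpoly : 2 ^ 2 ≤ 2 * (1 + 2 * (2 * (x * (1 - x)))) * (x + 1 / 2) ^ 2 := by
        obtain ⟨u, rfl⟩ : ∃ u, x = u + 1 / 2 := ⟨x - 1 / 2, by ring⟩
        have hu : 0 ≤ u := by linarith
        have hu' : u ≤ 1 / 2 := by linarith
        have hu2 : u ^ 2 ≤ 1 / 4 := by nlinarith
        have hu3 : u ^ 3 ≤ 1 / 8 := by nlinarith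
        have : 0 ≤ u * (2 - u - 4 * u ^ 2 - 2 * u ^ 3) := mul_nonneg hu (by linarith)
        linarith
      exact hpoly.trans (by gcongr)
  have heq : (s * (x ^ 2 - 1 / 4) + a - b) * (a + b) =
      (x - 1 / 2) * (s * (a + b) * (x + 1 / 2) - 2) := by
    linear_combination ha2 - hb2
  have := nonneg_of_mul_nonneg_left (heq ▸ key) ht
  linarith
end

section
/- Let a, b, c, d be positive real numbers with a² + b² + c² + d² = 1. Then √(1 − a) + √(1 − b) + √(1 − c) + √(1 − d) ≥ √a + √b + √c + √d. -/
/-- The parabola `-√2 (x² - 1/4)` lies below `√(1 - x) - √x` and touches it at `x = 1/2`. -/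
theorem neg_sqrt_two_mul_le_sqrt_one_sub_sub_sqrt {x : ℝ} (h0 : 0 < x) (h1 : x < 1) :
    -√2 * (x ^ 2 - 1 / 4) ≤ √(1 - x) - √x := by
  have hp : 0 < √x := Real.sqrt_pos.2 h0
  have hq : 0 < √(1 - x) := Real.sqrt_pos.2 (by linarith)
  have hp2 : √x ^ 2 = x := Real.sq_sqrt h0.le
  have hq2 : √(1 - x) ^ 2 = 1 - x := Real.sq_sqrt (by linarith)
  have hr : 0 < √(2 : ℝ) := by positivity
  have hr2 : √(2 : ℝ) ^ 2 = 2 := Real.sq_sqrt (by norm_num)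
  generalize √x = p at *
  generalize √(1 - x) = q at *
  generalize √(2 : ℝ) = r at *
  have hS : 0 < p + q := by positivity
  have hS2 : (r * (p + q)) ^ 2 = 2 * (1 + 2 * (p * q)) := by
    linear_combination (p + q) ^ 2 * hr2 + 2 * hp2 + 2 * hq2
  have hpq : 2 * (p * q) ≤ 1 := by nlinarith [sq_nonneg (p - q)]
  have hpq2 : (p * q) ^ 2 = x * (1 - x) := by rw [mul_pow, hp2, hq2]
  have hprod : 0 ≤ (1 - 2 * x) * (4 - (1 + 2 * x) * (r * (p + q))) := by
    have hrS : 0 < r * (p + q) := by positivity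
    rcases le_total x (1 / 2) with h | h
    · have : r * (p + q) ≤ 2 := by nlinarith
      exact mul_nonneg (by linarith) (by nlinarith)
    · have hlow : 2 * (1 + 4 * (x * (1 - x))) ≤ (r * (p + q)) ^ 2 := by
        nlinarith [mul_pos hp hq]
      have hcubic : 0 ≤ 8 - 2 * (2 * x - 1) - 4 * (2 * x - 1) ^ 2 - (2 * x - 1) ^ 3 := by
        have ht0 : 0 ≤ 2 * x - 1 := by linarith
        have ht1 : 2 * x - 1 ≤ 1 := by linarith
        linarith [pow_le_one₀ ht0 ht1 (n := 2), pow_le_one₀ ht0 ht1 (n := 3)]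
      have hsq : 4 ^ 2 ≤ ((1 + 2 * x) * (r * (p + q))) ^ 2 := by
        rw [mul_pow]
        have := mul_le_mul_of_nonneg_left hlow (sq_nonneg (1 + 2 * x))
        nlinarith [mul_nonneg (by linarith : 0 ≤ 2 * x - 1) hcubic]
      have : 4 ≤ (1 + 2 * x) * (r * (p + q)) :=
        (abs_le_of_sq_le_sq' hsq (by positivity)).2
      exact mul_nonneg_of_nonpos_of_nonpos (by linarith) (by linarith)
  have hmul : 0 ≤ (p + q) * (q - p + r * (x ^ 2 - 1 / 4)) := by
    have : (p + q) * (q - p + r * (x ^ 2 - 1 / 4)) =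
        (1 - 2 * x) * (4 - (1 + 2 * x) * (r * (p + q))) / 4 := by
      linear_combination hq2 - hp2
    rw [this]
    linarith
  linarith [nonneg_of_mul_nonneg_right hmul hS]

theorem stmt_17 (a b c d : ℝ) (ha : 0 < a) (hb : 0 < b) (hc : 0 < c) (hd : 0 < d)
    (hsum : a ^ 2 + b ^ 2 + c ^ 2 + d ^ 2 = 1) :
    Real.sqrt (1 - a) + Real.sqrt (1 - b) + Real.sqrt (1 - c) + Real.sqrt (1 - d) ≥
      Real.sqrt a + Real.sqrt b + Real.sqrt c + Real.sqrt d := by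
  have key := @neg_sqrt_two_mul_le_sqrt_one_sub_sub_sqrt
  have ha1 : a < 1 := by nlinarith [pow_pos hb 2, pow_pos hc 2, pow_pos hd 2]
  have hb1 : b < 1 := by nlinarith [pow_pos ha 2, pow_pos hc 2, pow_pos hd 2]
  have hc1 : c < 1 := by nlinarith [pow_pos ha 2, pow_pos hb 2, pow_pos hd 2]
  have hd1 : d < 1 := by nlinarith [pow_pos ha 2, pow_pos hb 2, pow_pos hc 2]
  have hzero : -√2 * (a ^ 2 - 1 / 4) + -√2 * (b ^ 2 - 1 / 4) + -√2 * (c ^ 2 - 1 / 4) +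
      -√2 * (d ^ 2 - 1 / 4) = 0 := by
    linear_combination -√2 * hsum
  linarith [key ha ha1, key hb hb1, key hc hc1, key hd hd1]
end

section
/- Let a, b, c be positive real numbers with a + b + c = 1. Then 1/(1 − a) + 1/(1 − b) + 1/(1 − c) ≥ 2/(1 + a) + 2/(1 + b) + 2/(1 + c). -/
/-- The tangent line at `1 / 3` bounds `x ↦ 1 / (1 - x) - 2 / (1 + x)` from below on `(0, 1)`. -/
lemma tangent_line_le_one_div_sub_two_div {x : ℝ} (hx₀ : 0 < x) (hx₁ : x < 1) :
    27 / 8 * (x - 1 / 3) ≤ 1 / (1 - x) - 2 / (1 + x) := by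
  have h₁ : 0 < 1 - x := sub_pos.2 hx₁
  have h₂ : 0 < 1 + x := by positivity
  have key : 1 / (1 - x) - 2 / (1 + x) - 27 / 8 * (x - 1 / 3) =
      (3 * x - 1) ^ 2 * (3 * x + 1) / (8 * ((1 - x) * (1 + x))) := by
    field_simp
    ring
  have : 0 ≤ (3 * x - 1) ^ 2 * (3 * x + 1) / (8 * ((1 - x) * (1 + x))) := by positivity
  linarith

theorem stmt_18 (a b c : ℝ) (ha : 0 < a) (hb : 0 < b) (hc : 0 < c)
    (hsum : a + b + c = 1) :
    1 / (1 - a) + 1 / (1 - b) + 1 / (1 - c) ≥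
      2 / (1 + a) + 2 / (1 + b) + 2 / (1 + c) := by
  have h₁ := tangent_line_le_one_div_sub_two_div ha (by linarith)
  have h₂ := tangent_line_le_one_div_sub_two_div hb (by linarith)
  have h₃ := tangent_line_le_one_div_sub_two_div hc (by linarith)
  linarith
end
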